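/- Let 6 ≤ n ≤ 8 and let G be an invertible n×n real matrix whose rows g₁,…,gₙ have Gram matrix Γ_{Eₙ} (diagonal entries 2, entries (1,2),(2,1),(1,3),(3,1) equal to 0, all other off-diagonal entries 1). For every subset S ⊆ {4,…,n} with |S| = i, writing x_S = Σ_{j∈S} g_j: (a) |T_f(x_S + g₁) ∩ C⁰| = 1 + (n − 3 − i); (b) |T_f(x_S + g₂ + g₁) ∩ C⁰| = |T_f(x_S + g₃ + g₁) ∩ C⁰| = 1 + 2(n − 3 − i) + C(n − 3 − i, 2); and (c) |T_f(x_S + g₂ + g₃ + g₁) ∩ C⁰| = 1 + 3(n − 3 − i) + 3·C(n − 3 − i, 2) + C(n − 3 − i, 3), where C(·,·) is the binomial coefficient. (Summing these cardinalities over the C(n−3,i) subsets of each size i gives the exponential piece count of the decision boundary function of Eₙ.) -/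

import Mathlib

open Matrix Finset

/-- Euclidean norm of a vector in `ℝⁿ`. -/
noncomputable def nrm {n : ℕ} (v : Fin n → ℝ) : ℝ := Real.sqrt (∑ i, v i ^ 2)

/-- The lattice generated by the rows of `G`. -/
def latticePt {n : ℕ} (G : Matrix (Fin n) (Fin n) ℝ) (x : Fin n → ℝ) : Prop :=
  ∃ z : Fin n → ℤ, x = (fun i => (z i : ℝ)) ᵥ* G

/-- The Voronoi region of `x` in the lattice generated by `G`. -/
def Vor {n : ℕ} (G : Matrix (Fin n) (Fin n) ℝ) (x : Fin n → ℝ) : Set (Fin n → ℝ) :=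
  {y | ∀ lam : Fin n → ℝ, latticePt G lam → nrm (y - x) ≤ nrm (y - lam)}

/-- `x'` shares an `(n−1)`-dimensional Voronoi facet with `x`. -/
def sharesFacet {n : ℕ} (G : Matrix (Fin n) (Fin n) ℝ) (x x' : Fin n → ℝ) : Prop :=
  Module.finrank ℝ (affineSpan ℝ (Vor G x ∩ Vor G x')).direction = n - 1

/-- The corner set `C^b = {zG : z ∈ {0,1}ⁿ, z₁ = b}`. -/
def cornerSet {n : ℕ} [NeZero n] (G : Matrix (Fin n) (Fin n) ℝ) (b : ℝ) :
    Set (Fin n → ℝ) :=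
  {x | ∃ z : Fin n → ℝ, (∀ i, z i = 0 ∨ z i = 1) ∧ z 0 = b ∧ x = z ᵥ* G}

/-- The `Eₙ` Gram matrix: diagonal entries `2`, entries `(1,2)`, `(2,1)`, `(1,3)`, `(3,1)`
equal to `0` (in 1-based indexing), all other off-diagonal entries `1`. -/
def gramE (n : ℕ) : Matrix (Fin n) (Fin n) ℝ :=
  Matrix.of fun i j =>
    if i = j then 2
    else if ((i : ℕ) = 0 ∧ (j : ℕ) = 1) ∨ ((i : ℕ) = 1 ∧ (j : ℕ) = 0) ∨
            ((i : ℕ) = 0 ∧ (j : ℕ) = 2) ∨ ((i : ℕ) = 2 ∧ (j : ℕ) = 0) then 0 else 1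

/-! ### Facets of Voronoi regions -/

lemma dotProduct_self_sub {n : ℕ} (u v : Fin n → ℝ) :
    (u - v) ⬝ᵥ (u - v) = u ⬝ᵥ u - 2 * (u ⬝ᵥ v) + v ⬝ᵥ v := by
  simp only [sub_dotProduct, dotProduct_sub, dotProduct_comm v u]
  ring

lemma dotProduct_self_nonneg_real {n : ℕ} (u : Fin n → ℝ) : 0 ≤ u ⬝ᵥ u :=
  Finset.sum_nonneg fun i _ => mul_self_nonneg (u i)

lemma nrm_le_nrm_iff {n : ℕ} (u v : Fin n → ℝ) : nrm u ≤ nrm v ↔ u ⬝ᵥ u ≤ v ⬝ᵥ v := by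
  have h (w : Fin n → ℝ) : ∑ i, w i ^ 2 = w ⬝ᵥ w := by simp [dotProduct, sq]
  rw [nrm, nrm, Real.sqrt_le_sqrt_iff (by positivity), h, h]

lemma mem_Vor_iff {n : ℕ} (G : Matrix (Fin n) (Fin n) ℝ) (x y : Fin n → ℝ) :
    y ∈ Vor G x ↔ ∀ p, latticePt G p →
      2 * ((y - x) ⬝ᵥ (p - x)) ≤ (p - x) ⬝ᵥ (p - x) := by
  refine forall₂_congr fun p _ => ?_
  rw [nrm_le_nrm_iff, ← sub_sub_sub_cancel_right y p x, dotProduct_self_sub (y - x) (p - x)]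
  constructor <;> intro h <;> linarith

/-- The linear functional `u ↦ a ⬝ᵥ u`. -/
def dotLin {n : ℕ} (a : Fin n → ℝ) : (Fin n → ℝ) →ₗ[ℝ] ℝ := dotProductBilin ℝ ℝ a

lemma dotLin_apply {n : ℕ} (a u : Fin n → ℝ) : dotLin a u = a ⬝ᵥ u := rfl

lemma finrank_ker_dotLin {n : ℕ} {a : Fin n → ℝ} (ha : a ≠ 0) :
    Module.finrank ℝ (LinearMap.ker (dotLin a)) = n - 1 := by
  have hne : dotLin a ≠ 0 := fun h => ha <| by
    have := LinearMap.congr_fun h a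
    simpa [dotLin_apply] using this
  have := Module.Dual.finrank_ker_add_one_of_ne_zero (f := dotLin a) hne
  rw [Module.finrank_fin_fun] at this
  omega

lemma vectorSpan_le_ker_dotLin {n : ℕ} {W : Set (Fin n → ℝ)} {a x : Fin n → ℝ} {c : ℝ}
    (h : ∀ y ∈ W, (y - x) ⬝ᵥ a = c) : vectorSpan ℝ W ≤ LinearMap.ker (dotLin a) := by
  rw [vectorSpan_def, Submodule.span_le]
  rintro _ ⟨y, hy, z, hz, rfl⟩
  have : (y - x) ⬝ᵥ a - (z - x) ⬝ᵥ a = 0 := by rw [h y hy, h z hz, sub_self]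
  rw [← sub_dotProduct, sub_sub_sub_cancel_right, dotProduct_comm] at this
  exact this

/-- On the common boundary of two Voronoi regions the bisector equation holds. -/
lemma dotProduct_eq_of_mem_Vor_inter {n : ℕ} {G : Matrix (Fin n) (Fin n) ℝ}
    {x x' y : Fin n → ℝ} (hx : latticePt G x) (hx' : latticePt G x')
    (hy : y ∈ Vor G x ∩ Vor G x') :
    (y - x) ⬝ᵥ (x' - x) = ((x' - x) ⬝ᵥ (x' - x)) / 2 := by
  have h1 := (mem_Vor_iff G x y).1 hy.1 x' hx'
  have h2 := (mem_Vor_iff G x' y).1 hy.2 x hx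
  have e : (y - x') ⬝ᵥ (x - x') = (x' - x) ⬝ᵥ (x' - x) - (y - x) ⬝ᵥ (x' - x) := by
    rw [← sub_dotProduct, ← neg_dotProduct_neg, neg_sub, neg_sub]
    congr 1
    abel
  have e' : (x - x') ⬝ᵥ (x - x') = (x' - x) ⬝ᵥ (x' - x) := by
    rw [← neg_dotProduct_neg, neg_sub]
  linarith

/-- If a lattice point `p` other than `x`, `x'` lies in the closed ball with diameter `[x, x']`,
then `x` and `x'` do not share a facet. -/
lemma not_sharesFacet_of_dotProduct_nonpos {n : ℕ} (hn : 2 ≤ n)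
    {G : Matrix (Fin n) (Fin n) ℝ} {x x' p : Fin n → ℝ}
    (hx : latticePt G x) (hx' : latticePt G x') (hp : latticePt G p)
    (hp' : latticePt G (x + x' - p)) (hxx' : x ≠ x') (hpx : p ≠ x) (hpx' : p ≠ x')
    (h : (p - x) ⬝ᵥ (p - x') ≤ 0) : ¬ sharesFacet G x x' := by
  rw [sharesFacet, direction_affineSpan]
  intro hrank
  set W := Vor G x ∩ Vor G x'
  obtain ⟨y₀, hy₀⟩ : W.Nonempty := by
    by_contra hne
    rw [Set.not_nonempty_iff_eq_empty.1 hne, vectorSpan_empty, finrank_bot] at hrank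
    omega
  set a := x' - x with ha
  set b := p - x with hb
  have ha0 : a ≠ 0 := sub_ne_zero.2 hxx'.symm
  have hba : b ⬝ᵥ b ≤ b ⬝ᵥ a := by
    have : p - x' = b - a := by simp [ha, hb]
    rw [this, dotProduct_sub] at h
    linarith
  have hA : ∀ y ∈ W, (y - x) ⬝ᵥ a = (a ⬝ᵥ a) / 2 := fun y hy =>
    dotProduct_eq_of_mem_Vor_inter hx hx' hy
  have hB : ∀ y ∈ W, (y - x) ⬝ᵥ b = (b ⬝ᵥ b) / 2 := by
    intro y hy
    have h1 := (mem_Vor_iff G x y).1 hy.1 p hp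
    have h2 := (mem_Vor_iff G x y).1 hy.1 _ hp'
    have e : x + x' - p - x = a - b := by rw [ha, hb]; abel
    rw [e, dotProduct_self_sub, dotProduct_sub, hA y hy, dotProduct_comm a b] at h2
    rw [← hb] at h1
    linarith
  have hker : vectorSpan ℝ W = LinearMap.ker (dotLin a) :=
    Submodule.eq_of_le_of_finrank_eq (vectorSpan_le_ker_dotLin hA)
      (by rw [hrank, finrank_ker_dotLin ha0])
  have haa : a ⬝ᵥ a ≠ 0 := fun h0 => ha0 (dotProduct_self_eq_zero.1 h0)
  obtain ⟨t, ht⟩ : ∃ t : ℝ, b = t • a := by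
    refine ⟨(a ⬝ᵥ b) / (a ⬝ᵥ a), sub_eq_zero.1 (dotProduct_self_eq_zero.1 ?_)⟩
    set u := b - ((a ⬝ᵥ b) / (a ⬝ᵥ a)) • a with hu
    have hau : a ⬝ᵥ u = 0 := by
      rw [hu, dotProduct_sub, dotProduct_smul, smul_eq_mul]
      field_simp
      ring
    have hbu : b ⬝ᵥ u = 0 :=
      vectorSpan_le_ker_dotLin hB (hker ▸ (show u ∈ LinearMap.ker (dotLin a) from hau))
    conv_lhs => rw [hu]
    rw [sub_dotProduct, smul_dotProduct, ← hu, hau, hbu]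
    simp
  have h1 := hA y₀ hy₀
  have h2 := hB y₀ hy₀
  rw [ht, dotProduct_smul, smul_dotProduct, dotProduct_smul, h1] at h2
  simp only [smul_eq_mul] at h2
  have h3 : t * (t - 1) = 0 := by
    have : (a ⬝ᵥ a) * (t * (t - 1)) = 0 := by linarith
    exact (mul_eq_zero.1 this).resolve_left haa
  rcases mul_eq_zero.1 h3 with h4 | h4
  · rw [h4, zero_smul] at ht
    exact hpx (sub_eq_zero.1 ht)
  · rw [sub_eq_zero.1 h4, one_smul] at ht
    exact hpx' (sub_left_injective ht)

lemma add_mem_Vor {n : ℕ} {G : Matrix (Fin n) (Fin n) ℝ} {x x' w : Fin n → ℝ}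
    (hmin : ∀ p, latticePt G p → p ≠ x → 2 ≤ (p - x) ⬝ᵥ (p - x))
    (hmin' : ∀ p, latticePt G p → p ≠ x' → 2 ≤ (p - x') ⬝ᵥ (p - x'))
    (hd : (x' - x) ⬝ᵥ (x' - x) = 2) (hw : w ⬝ᵥ (x' - x) = 0) (hw' : w ⬝ᵥ w ≤ 1 / 8) :
    (1 / 2 : ℝ) • (x + x') + w ∈ Vor G x := by
  rw [mem_Vor_iff]
  intro p hp
  have e : (1 / 2 : ℝ) • (x + x') + w - x = (1 / 2 : ℝ) • (x' - x) + w := by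
    ext i
    simp
    ring
  rw [e, add_dotProduct, smul_dotProduct, smul_eq_mul]
  by_cases h1 : p = x
  · simp [h1]
  by_cases h2 : p = x'
  · rw [h2, hw, hd]
    norm_num
  have hq := hmin p hp h1
  have hq' := hmin' p hp h2
  rw [← sub_sub_sub_cancel_right p x' x, dotProduct_self_sub, hd] at hq'
  have hcs : (w ⬝ᵥ (p - x)) ^ 2 ≤ (w ⬝ᵥ w) * ((p - x) ⬝ᵥ (p - x)) := by
    simpa [dotProduct, sq] using
      Finset.sum_mul_sq_le_sq_mul_sq Finset.univ w (p - x)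
  rw [dotProduct_comm (p - x) (x' - x)] at hq'
  nlinarith

lemma sharesFacet_of_dotProduct_eq_two {n : ℕ} {G : Matrix (Fin n) (Fin n) ℝ}
    {x x' : Fin n → ℝ} (hx : latticePt G x) (hx' : latticePt G x')
    (hmin : ∀ p, latticePt G p → p ≠ x → 2 ≤ (p - x) ⬝ᵥ (p - x))
    (hmin' : ∀ p, latticePt G p → p ≠ x' → 2 ≤ (p - x') ⬝ᵥ (p - x'))
    (hd : (x' - x) ⬝ᵥ (x' - x) = 2) : sharesFacet G x x' := by
  have ha0 : x' - x ≠ 0 := fun h => by simp [h] at hd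
  have hmem (w : Fin n → ℝ) (hw : w ⬝ᵥ (x' - x) = 0) (hw' : w ⬝ᵥ w ≤ 1 / 8) :
      (1 / 2 : ℝ) • (x + x') + w ∈ Vor G x ∩ Vor G x' := by
    refine ⟨add_mem_Vor hmin hmin' hd hw hw', ?_⟩
    rw [add_comm x x']
    refine add_mem_Vor hmin' hmin ?_ ?_ hw'
    · rwa [← neg_dotProduct_neg, neg_sub]
    · rw [← neg_sub, dotProduct_neg, hw, neg_zero]
  suffices h : vectorSpan ℝ (Vor G x ∩ Vor G x') = LinearMap.ker (dotLin (x' - x)) by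
    rw [sharesFacet, direction_affineSpan, h, finrank_ker_dotLin ha0]
  refine le_antisymm (vectorSpan_le_ker_dotLin fun y hy =>
    dotProduct_eq_of_mem_Vor_inter hx hx' hy) fun u hu => ?_
  rw [LinearMap.mem_ker, dotLin_apply, dotProduct_comm] at hu
  have hu0 : 0 ≤ u ⬝ᵥ u := dotProduct_self_nonneg_real u
  set c : ℝ := 1 / (8 * (1 + u ⬝ᵥ u)) with hc
  have hcpos : 0 < c := by positivity
  have hcu : c * (1 + u ⬝ᵥ u) = 1 / 8 := by rw [hc]; field_simp
  have hsub := vsub_mem_vectorSpan ℝ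
    (hmem (c • u) (by rw [smul_dotProduct, hu, smul_zero])
      (by rw [smul_dotProduct, dotProduct_smul, smul_eq_mul, smul_eq_mul]; nlinarith))
    (hmem 0 (zero_dotProduct _) (by rw [zero_dotProduct]; norm_num))
  rw [vsub_eq_sub, add_zero, add_sub_cancel_left] at hsub
  exact (Submodule.smul_mem_iff _ hcpos.ne').1 hsub

/-! ### The integral quadratic form of the `Eₙ` basis -/

/-- The integral bilinear form in which all basis vectors have norm `2` and inner product `1`,
except that `a` is orthogonal to `b` and to `c`. -/
def formE {n : ℕ} (a b c : Fin n) (z w : Fin n → ℤ) : ℤ :=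
  ∑ i, z i * w i + (∑ i, z i) * (∑ i, w i)
    - (z a * w b + z b * w a + z a * w c + z c * w a)

lemma gramE_apply {n : ℕ} {a b c : Fin n} (ha : (a : ℕ) = 0) (hb : (b : ℕ) = 1)
    (hc : (c : ℕ) = 2) (i j : Fin n) :
    gramE n i j = (if i = j then 1 else 0) + 1
      - ((if i = a then 1 else 0) * (if j = b then 1 else 0)
        + (if i = b then 1 else 0) * (if j = a then 1 else 0)
        + (if i = a then 1 else 0) * (if j = c then 1 else 0)
        + (if i = c then 1 else 0) * (if j = a then 1 else 0)) := by
  simp only [gramE, Matrix.of_apply, Fin.ext_iff, ha, hb, hc]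
  split_ifs <;> first | omega | norm_num

lemma dotProduct_eq_formE {n : ℕ} {G : Matrix (Fin n) (Fin n) ℝ}
    (hGram : G * G.transpose = gramE n) {a b c : Fin n} (ha : (a : ℕ) = 0)
    (hb : (b : ℕ) = 1) (hc : (c : ℕ) = 2) (z w : Fin n → ℤ) :
    ((fun i => (z i : ℝ)) ᵥ* G) ⬝ᵥ ((fun i => (w i : ℝ)) ᵥ* G) = (formE a b c z w : ℝ) := by
  rw [← dotProduct_mulVec, ← mulVec_transpose, mulVec_mulVec, hGram]
  simp only [dotProduct, mulVec, gramE_apply ha hb hc, formE]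
  push_cast
  simp only [add_mul, sub_mul, Finset.sum_add_distrib, Finset.sum_sub_distrib, mul_add, mul_sub,
    ite_mul, mul_ite, one_mul, zero_mul, mul_one, mul_zero, Finset.sum_ite_eq,
    Finset.sum_ite_eq', Finset.mem_univ, if_true, Finset.sum_mul]

lemma even_formE_self {n : ℕ} (a b c : Fin n) (z : Fin n → ℤ) : Even (formE a b c z z) := by
  have h : Even (∑ i, z i * z i + ∑ i, z i) := by
    rw [← Finset.sum_add_distrib]
    exact Finset.even_sum _ fun i _ => by
      rw [← mul_add_one]; exact Int.even_mul_succ_self _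
  have h' : Even ((∑ i, z i) * (∑ i, z i) - ∑ i, z i) := by
    rw [← mul_sub_one]; exact Int.even_mul_pred_self _
  have h'' : Even (2 * (z a * z b + z a * z c)) := even_two_mul _
  have e : formE a b c z z = ∑ i, z i * z i + ∑ i, z i
      + ((∑ i, z i) * (∑ i, z i) - ∑ i, z i) - 2 * (z a * z b + z a * z c) := by
    rw [formE]
    ring
  exact e ▸ (h.add h').sub h''

lemma formE_single_right {n : ℕ} (a b c : Fin n) (z : Fin n → ℤ) (i : Fin n) :
    formE a b c z (Pi.single i 1) = z i + ∑ j, z j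
      - ((if b = i then z a else 0) + (if a = i then z b else 0)
        + (if c = i then z a else 0) + (if a = i then z c else 0)) := by
  simp [formE, Pi.single_apply]

lemma formE_sub_right {n : ℕ} (a b c : Fin n) (z w w' : Fin n → ℤ) :
    formE a b c z (w - w') = formE a b c z w - formE a b c z w' := by
  simp [formE, mul_sub, Finset.sum_sub_distrib]
  ring

lemma formE_neg_right {n : ℕ} (a b c : Fin n) (z w : Fin n → ℤ) :
    formE a b c z (-w) = - formE a b c z w := by
  simp [formE]
  ring

lemma sum_eq_add_three {n : ℕ} {M : Type*} [AddCommMonoid M] {a b c : Fin n} (hab : a ≠ b)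
    (hac : a ≠ c) (hbc : b ≠ c) (f : Fin n → M) :
    ∑ i, f i = f a + f b + f c + ∑ i ∈ univ \ {a, b, c}, f i := by
  rw [← Finset.sum_sdiff (Finset.subset_univ {a, b, c}), add_comm]
  congr 1
  rw [Finset.sum_insert (by simp [hab, hac]), Finset.sum_pair hbc, add_assoc]

/-- The difference vectors `d` with `d a = 1` and entries in `{-1, 0, 1}` that have norm `2`. -/
def RootShape {n : ℕ} (a b c : Fin n) (d : Fin n → ℤ) : Prop :=
  0 ≤ d b ∧ 0 ≤ d c ∧ (∀ i ∈ univ \ {a, b, c}, d i ≤ 0) ∧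
    (-∑ i ∈ univ \ {a, b, c}, d i = d b + d c ∨
      -∑ i ∈ univ \ {a, b, c}, d i = d b + d c + 1)

lemma formE_self_of_rootShape {n : ℕ} {a b c : Fin n} (hab : a ≠ b) (hac : a ≠ c) (hbc : b ≠ c)
    {d : Fin n → ℤ} (hda : d a = 1) (hlo : ∀ i, -1 ≤ d i) (hhi : ∀ i, d i ≤ 1)
    (h : RootShape a b c d) : formE a b c d d = 2 := by
  obtain ⟨hb, hc, hneg, hT⟩ := h
  have hsq : ∑ i ∈ univ \ {a, b, c}, d i * d i = -∑ i ∈ univ \ {a, b, c}, d i := by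
    rw [← Finset.sum_neg_distrib]
    refine Finset.sum_congr rfl fun i hi => ?_
    have h1 := hneg i hi
    have h2 := hlo i
    obtain h3 | h3 : d i = 0 ∨ d i = -1 := by omega
    all_goals rw [h3]; norm_num
  have hb' : d b * d b = d b := by
    have := hhi b
    obtain h3 | h3 : d b = 0 ∨ d b = 1 := by omega
    all_goals rw [h3]; norm_num
  have hc' : d c * d c = d c := by
    have := hhi c
    obtain h3 | h3 : d c = 0 ∨ d c = 1 := by omega
    all_goals rw [h3]; norm_num
  rw [formE, sum_eq_add_three hab hac hbc, sum_eq_add_three hab hac hbc d, hsq, hda, hb', hc']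
  rcases hT with hT | hT
  · rw [show ∑ i ∈ univ \ {a, b, c}, d i = -(d b + d c) by omega]
    ring
  · rw [show ∑ i ∈ univ \ {a, b, c}, d i = -(d b + d c + 1) by omega]
    ring

/-- A vector that is not of root shape fails to be Voronoi relevant, as witnessed by a root. -/
lemma exists_formE_le_of_not_rootShape {n : ℕ} {a b c : Fin n} (hab : a ≠ b) (hac : a ≠ c)
    (hbc : b ≠ c) {d : Fin n → ℤ} (hda : d a = 1) (hhi : ∀ i, d i ≤ 1)
    (h : ¬ RootShape a b c d) :
    ∃ l : Fin n → ℤ, l ≠ 0 ∧ l ≠ d ∧ formE a b c l l ≤ formE a b c d l := by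
  have hs := sum_eq_add_three hab hac hbc d
  set T := ∑ i ∈ univ \ {a, b, c}, d i with hTdef
  suffices ∃ l : Fin n → ℤ, l ≠ d ∧ formE a b c l l = 2 ∧ 2 ≤ formE a b c d l by
    obtain ⟨l, h1, h2, h3⟩ := this
    refine ⟨l, ?_, h1, h2.trans_le h3⟩
    rintro rfl
    simp [formE] at h2
  have hsub (i j : Fin n) (hi : a ≠ i) (hj : a ≠ j) (hij : i ≠ j) :
      Pi.single i 1 - Pi.single j 1 ≠ d ∧
      formE a b c (Pi.single i 1 - Pi.single j 1) (Pi.single i 1 - Pi.single j 1) = 2 := by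
    constructor
    · rintro rfl
      simp [hi, hj] at hda
    · simp [formE_sub_right, formE_single_right, hij, hij.symm, hi, hj]
  have hneg (i : Fin n) (hi : a ≠ i) :
      -Pi.single i 1 ≠ d ∧ formE a b c (-Pi.single i 1) (-Pi.single i 1) = 2 := by
    constructor
    · rintro rfl
      simp [hi] at hda
    · simp [formE_neg_right, formE_single_right, hi]
  by_cases hT : 0 ≤ T
  · refine ⟨Pi.single a 1, ?_, ?_, ?_⟩
    · rintro rfl
      refine h ⟨by simp [hab.symm], by simp [hac.symm], fun i hi => ?_, Or.inl ?_⟩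
      · simp only [mem_sdiff, mem_univ, mem_insert, mem_singleton, true_and, not_or] at hi
        simp [hi.1]
      · rw [← hTdef, hTdef]
        simp [hab.symm, hac.symm]
    · simp [formE_single_right, hab.symm, hac.symm]
    · simp [formE_single_right, hab.symm, hac.symm]
      omega
  obtain ⟨j, hj, hdj⟩ : ∃ j ∈ univ \ {a, b, c}, d j < 0 := by
    by_contra! hcon
    exact hT (Finset.sum_nonneg hcon)
  simp only [mem_sdiff, mem_univ, mem_insert, mem_singleton, true_and, not_or] at hj
  obtain ⟨hja, hjb, hjc⟩ := hj
  by_cases hpos : ∃ i ∈ univ \ {a, b, c}, 0 < d i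
  · obtain ⟨i, hi, hdi⟩ := hpos
    simp only [mem_sdiff, mem_univ, mem_insert, mem_singleton, true_and, not_or] at hi
    have hij : i ≠ j := by rintro rfl; omega
    refine ⟨_, (hsub i j (Ne.symm hi.1) (Ne.symm hja) hij).1,
      (hsub i j (Ne.symm hi.1) (Ne.symm hja) hij).2, ?_⟩
    rw [formE_sub_right, formE_single_right, formE_single_right]
    simp only [Ne.symm hi.1, Ne.symm hi.2.1, Ne.symm hi.2.2, Ne.symm hja, Ne.symm hjb,
      Ne.symm hjc, if_false]
    omega
  push Not at hpos
  have hhb := hhi b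
  have hhc := hhi c
  by_cases hb : d b < 0
  · by_cases hc : 0 < d c
    · refine ⟨_, (hsub c b hac hab hbc.symm).1, (hsub c b hac hab hbc.symm).2, ?_⟩
      rw [formE_sub_right, formE_single_right, formE_single_right]
      simp only [hab, hac, hbc, hbc.symm, if_false, if_true]
      omega
    · refine ⟨_, (hneg b hab).1, (hneg b hab).2, ?_⟩
      rw [formE_neg_right, formE_single_right]
      simp only [hab, hbc.symm, if_false, if_true]
      omega
  by_cases hc : d c < 0
  · by_cases hb' : 0 < d b
    · refine ⟨_, (hsub b c hab hac hbc).1, (hsub b c hab hac hbc).2, ?_⟩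
      rw [formE_sub_right, formE_single_right, formE_single_right]
      simp only [hab, hac, hbc, hbc.symm, if_false, if_true]
      omega
    · refine ⟨_, (hneg c hac).1, (hneg c hac).2, ?_⟩
      rw [formE_neg_right, formE_single_right]
      simp only [hac, hbc, if_false, if_true]
      omega
  have hk : ¬ (-T = d b + d c ∨ -T = d b + d c + 1) := fun hk =>
    h ⟨by omega, by omega, hpos, hk⟩
  by_cases hlarge : d b + d c + 2 ≤ -T
  · refine ⟨_, (hneg j (Ne.symm hja)).1, (hneg j (Ne.symm hja)).2, ?_⟩
    rw [formE_neg_right, formE_single_right]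
    simp only [Ne.symm hja, Ne.symm hjb, Ne.symm hjc, if_false]
    omega
  · refine ⟨Pi.single b 1, ?_, ?_, ?_⟩
    · rintro rfl
      simp [hab] at hda
    · simp [formE_single_right, hab, hbc.symm]
    · rw [formE_single_right]
      simp only [hab, hbc.symm, if_false, if_true]
      omega

/-! ### Corners -/

/-- The integral indicator vector of a finset. -/
def indVec {n : ℕ} (A : Finset (Fin n)) : Fin n → ℤ := fun i => if i ∈ A then 1 else 0

/-- The lattice point with integral coordinate vector `z`. -/
def intPt {n : ℕ} (G : Matrix (Fin n) (Fin n) ℝ) (z : Fin n → ℤ) : Fin n → ℝ :=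
  (fun i => (z i : ℝ)) ᵥ* G

lemma latticePt_intPt {n : ℕ} (G : Matrix (Fin n) (Fin n) ℝ) (z : Fin n → ℤ) :
    latticePt G (intPt G z) := ⟨z, rfl⟩

lemma intPt_sub {n : ℕ} (G : Matrix (Fin n) (Fin n) ℝ) (z w : Fin n → ℤ) :
    intPt G (z - w) = intPt G z - intPt G w := by
  rw [intPt, intPt, intPt, ← sub_vecMul]
  congr 1
  ext i
  simp

lemma intPt_injective {n : ℕ} {G : Matrix (Fin n) (Fin n) ℝ} (hG : IsUnit G.det) :
    Function.Injective (intPt G) := by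
  intro z w h
  have := Matrix.vecMul_injective_of_isUnit ((Matrix.isUnit_iff_isUnit_det G).2 hG) h
  ext i
  exact_mod_cast congrFun this i

lemma intPt_indVec {n : ℕ} (G : Matrix (Fin n) (Fin n) ℝ) (A : Finset (Fin n)) :
    intPt G (indVec A) = ∑ j ∈ A, G j := by
  ext k
  rw [show (∑ j ∈ A, G j) k = ∑ j ∈ A, G j k from Finset.sum_apply k A fun j => G j]
  simp [intPt, indVec, vecMul, dotProduct]

lemma intPt_indVec_insert {n : ℕ} (G : Matrix (Fin n) (Fin n) ℝ) {A : Finset (Fin n)}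
    {j : Fin n} (hj : j ∉ A) :
    intPt G (indVec (insert j A)) = G j + intPt G (indVec A) := by
  rw [intPt_indVec, intPt_indVec]
  exact Finset.sum_insert (f := fun j => G j) hj

lemma indVec_injective {n : ℕ} : Function.Injective (indVec (n := n)) := by
  intro A B h
  ext i
  have := congrFun h i
  simp only [indVec] at this
  split_ifs at this <;> simp_all

lemma two_le_dotProduct_self {n : ℕ} {G : Matrix (Fin n) (Fin n) ℝ}
    (hGram : G * G.transpose = gramE n) {a b c : Fin n} (ha : (a : ℕ) = 0)
    (hb : (b : ℕ) = 1) (hc : (c : ℕ) = 2) (z : Fin n → ℤ) {p : Fin n → ℝ}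
    (hp : latticePt G p) (hne : p ≠ intPt G z) :
    2 ≤ (p - intPt G z) ⬝ᵥ (p - intPt G z) := by
  obtain ⟨w, rfl⟩ := hp
  change intPt G w ≠ _ at hne
  change 2 ≤ (intPt G w - _) ⬝ᵥ (intPt G w - _)
  have hpos : 0 < (intPt G w - intPt G z) ⬝ᵥ (intPt G w - intPt G z) :=
    lt_of_le_of_ne (dotProduct_self_nonneg_real _) fun h =>
      hne (sub_eq_zero.1 (dotProduct_self_eq_zero.1 h.symm))
  rw [← intPt_sub, intPt, dotProduct_eq_formE hGram ha hb hc] at hpos ⊢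
  have h2 := even_formE_self a b c (w - z)
  norm_cast at hpos ⊢
  obtain ⟨k, hk⟩ := h2
  omega

lemma sharesFacet_intPt_iff {n : ℕ} (hn : 2 ≤ n) {G : Matrix (Fin n) (Fin n) ℝ}
    (hG : IsUnit G.det) (hGram : G * G.transpose = gramE n) {a b c : Fin n}
    (ha : (a : ℕ) = 0) (hb : (b : ℕ) = 1) (hc : (c : ℕ) = 2) {z w : Fin n → ℤ}
    (hda : z a - w a = 1) (hlo : ∀ i, -1 ≤ z i - w i) (hhi : ∀ i, z i - w i ≤ 1) :
    sharesFacet G (intPt G z) (intPt G w) ↔ RootShape a b c (z - w) := by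
  have hab : a ≠ b := by rintro rfl; omega
  have hac : a ≠ c := by rintro rfl; omega
  have hbc : b ≠ c := by rintro rfl; omega
  constructor
  · contrapose!
    intro h
    obtain ⟨l, hl0, hld, hl⟩ := exists_formE_le_of_not_rootShape (d := z - w) hab hac hbc hda hhi h
    have e : intPt G z + intPt G w - intPt G (z - l) = intPt G (w - (-l)) := by
      rw [show w - -l = w - ((z - l) - z) by abel, intPt_sub G w, intPt_sub G (z - l) z]
      abel
    refine not_sharesFacet_of_dotProduct_nonpos hn (latticePt_intPt G z) (latticePt_intPt G w)
      (latticePt_intPt G (z - l)) (e ▸ latticePt_intPt G _) ?_ ?_ ?_ ?_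
    · intro h'
      rw [intPt_injective hG h', sub_self] at hda
      exact zero_ne_one hda
    · intro h'
      exact hl0 (by simpa using intPt_injective hG h')
    · intro h'
      apply hld
      rw [← intPt_injective hG h', sub_sub_cancel]
    · rw [← intPt_sub, ← intPt_sub, intPt, intPt, dotProduct_eq_formE hGram ha hb hc]
      have e1 : z - l - z = -l := by abel
      have e2 : z - l - w = (z - w) - l := by abel
      have e3 : formE a b c (-l) (z - w) = -formE a b c (z - w) l := by
        simp only [formE, Pi.neg_apply, neg_mul, Finset.sum_neg_distrib,
          mul_comm ((z - w) _) (l _)]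
        ring
      have e4 : formE a b c (-l) l = -formE a b c l l := by
        simp only [formE, Pi.neg_apply, neg_mul, Finset.sum_neg_distrib]
        ring
      rw [e1, e2, formE_sub_right, e3, e4]
      norm_cast
      omega
  · intro h
    refine sharesFacet_of_dotProduct_eq_two (latticePt_intPt G z) (latticePt_intPt G w)
      (fun p hp hne => two_le_dotProduct_self hGram ha hb hc z hp hne)
      (fun p hp hne => two_le_dotProduct_self hGram ha hb hc w hp hne) ?_
    rw [← neg_dotProduct_neg, neg_sub, ← intPt_sub, intPt,
      dotProduct_eq_formE hGram ha hb hc,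
      formE_self_of_rootShape (d := z - w) hab hac hbc hda hlo hhi h]
    norm_num

lemma mem_cornerSet_zero_iff {n : ℕ} [NeZero n] (G : Matrix (Fin n) (Fin n) ℝ)
    (x : Fin n → ℝ) :
    x ∈ cornerSet G 0 ↔ ∃ B : Finset (Fin n), 0 ∉ B ∧ x = intPt G (indVec B) := by
  constructor
  · rintro ⟨z, hz, hz0, rfl⟩
    refine ⟨univ.filter fun i => z i = 1, by simp [hz0], ?_⟩
    rw [intPt]
    congr 1
    ext i
    rcases hz i with h | h <;> simp [indVec, h]
  · rintro ⟨B, hB, rfl⟩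
    refine ⟨fun i => (indVec B i : ℝ), fun i => ?_, by simp [indVec, hB], rfl⟩
    by_cases h : i ∈ B <;> simp [indVec, h]

/-! ### Counting -/

/-- The corners `B` whose difference from the corner `A` has root shape, in terms of finsets. -/
lemma rootShape_indVec_sub_iff {n : ℕ} {a b c : Fin n} (hab : a ≠ b) (hac : a ≠ c)
    (hbc : b ≠ c) {A B : Finset (Fin n)} (haA : a ∈ A) (haB : a ∉ B) :
    RootShape a b c (indVec A - indVec B) ↔
      A.erase a \ B ⊆ A ∩ {b, c} ∧ B \ A ⊆ univ \ {a, b, c} ∧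
      ((B \ A).card = (A.erase a \ B).card ∨ (B \ A).card = (A.erase a \ B).card + 1) := by
  have key : (A.erase a \ B ⊆ A ∩ {b, c} → B \ A ⊆ univ \ {a, b, c} →
      -∑ i ∈ univ \ {a, b, c}, (indVec A - indVec B) i = (B \ A).card ∧
      (indVec A - indVec B) b + (indVec A - indVec B) c = (A.erase a \ B).card) := by
    intro h1 h2
    constructor
    · rw [← Finset.sum_neg_distrib, Finset.card_eq_sum_ones, Nat.cast_sum,
        ← Finset.sum_subset h2]
      · refine Finset.sum_congr rfl fun i hi => ?_
        simp only [mem_sdiff] at hi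
        simp [indVec, hi.1, hi.2]
      · intro i hi hi'
        have h3 : i ∈ A → i ∈ B := by
          intro hiA
          by_contra hiB
          have := h1 (by simp_all : i ∈ A.erase a \ B)
          simp_all
        simp only [mem_sdiff, not_and, not_not] at hi'
        by_cases hA : i ∈ A
        · simp [indVec, hA, h3 hA]
        · simp [indVec, hA, show i ∉ B from fun h => hA (hi' h)]
    · have h3 : A.erase a \ B ⊆ {b, c} := h1.trans inter_subset_right
      have hbB : b ∈ B → b ∈ A := by
        intro hb
        by_contra hbA
        simpa using h2 (mem_sdiff.2 ⟨hb, hbA⟩)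
      have hcB : c ∈ B → c ∈ A := by
        intro hb
        by_contra hbA
        simpa using h2 (mem_sdiff.2 ⟨hb, hbA⟩)
      rw [← Finset.sum_pair hbc (f := fun i => (indVec A - indVec B) i),
        Finset.card_eq_sum_ones, Nat.cast_sum, ← Finset.sum_subset h3]
      · refine Finset.sum_congr rfl fun i hi => ?_
        simp only [mem_sdiff, mem_erase] at hi
        simp [indVec, hi.1, hi.2]
      · intro i hi hi'
        have hia : i ≠ a := by
          rintro rfl
          simp [hab, hac] at hi
        have hBA : i ∈ B → i ∈ A := by
          rcases mem_insert.1 hi with rfl | hi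
          · exact hbB
          · rwa [mem_singleton.1 hi]
        simp only [mem_sdiff, mem_erase, not_and, not_not] at hi'
        by_cases hA : i ∈ A
        · simp [indVec, hA, hi' ⟨hia, hA⟩]
        · simp [indVec, hA, show i ∉ B from fun h => hA (hBA h)]
  constructor
  · rintro ⟨hb, hc, hneg, hcard⟩
    have h1 : A.erase a \ B ⊆ A ∩ {b, c} := by
      intro i hi
      simp only [mem_sdiff, mem_erase] at hi
      by_contra hcon
      have := hneg i (by simp_all)
      simp [indVec, hi.1, hi.2] at this
    have h2 : B \ A ⊆ univ \ {a, b, c} := by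
      intro i hi
      simp only [mem_sdiff] at hi
      have hb' : i ≠ b := by
        rintro rfl
        simp [indVec, hi.1, hi.2] at hb
      have hc' : i ≠ c := by
        rintro rfl
        simp [indVec, hi.1, hi.2] at hc
      have ha' : i ≠ a := by
        rintro rfl
        exact haB hi.1
      simp [ha', hb', hc']
    obtain ⟨k1, k2⟩ := key h1 h2
    rw [k1, k2] at hcard
    exact ⟨h1, h2, by exact_mod_cast hcard⟩
  · rintro ⟨h1, h2, hcard⟩
    obtain ⟨k1, k2⟩ := key h1 h2
    have hnn (i : Fin n) (hi : i ∉ univ \ {a, b, c}) : 0 ≤ (indVec A - indVec B) i := by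
      have : i ∈ B → i ∈ A := by
        intro hB
        by_contra hA
        exact hi (h2 (mem_sdiff.2 ⟨hB, hA⟩))
      by_cases hA : i ∈ A <;> by_cases hB : i ∈ B <;> simp_all [indVec]
    refine ⟨hnn b (by simp), hnn c (by simp), fun i hi => ?_, ?_⟩
    · have : i ∈ A → i ∈ B := by
        intro hA
        by_contra hB
        have := h1 (by simp_all : i ∈ A.erase a \ B)
        simp_all
      by_cases hA : i ∈ A <;> by_cases hB : i ∈ B <;> simp_all [indVec]
    · rw [k1, k2]
      exact_mod_cast hcard

lemma card_filter_rootShape {n : ℕ} {a b c : Fin n} {A : Finset (Fin n)}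
    (haA : a ∈ A) :
    (univ.filter fun B : Finset (Fin n) => a ∉ B ∧
        A.erase a \ B ⊆ A ∩ {b, c} ∧ B \ A ⊆ univ \ {a, b, c} ∧
        ((B \ A).card = (A.erase a \ B).card ∨
          (B \ A).card = (A.erase a \ B).card + 1)).card =
      ∑ k ∈ range ((A.erase a ∩ {b, c}).card + 1), (A.erase a ∩ {b, c}).card.choose k *
        (((univ \ {a, b, c}) \ A).card.choose k + ((univ \ {a, b, c}) \ A).card.choose (k + 1)) := by
  set F := A.erase a ∩ {b, c}
  set C := (univ \ {a, b, c}) \ A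
  have hsum := Finset.sum_powerset_apply_card (fun k => C.card.choose k + C.card.choose (k + 1))
    (x := F)
  simp only [smul_eq_mul] at hsum
  rw [← hsum]
  have hcard (D : Finset (Fin n)) : C.card.choose D.card + C.card.choose (D.card + 1) =
      (C.powersetCard D.card ∪ C.powersetCard (D.card + 1)).card := by
    rw [card_union_of_disjoint (pairwise_disjoint_powersetCard C (by simp)),
      card_powersetCard, card_powersetCard]
  simp only [hcard]
  rw [← card_sigma]
  have hinv {D N : Finset (Fin n)} (hD : D ⊆ F) (hN : N ⊆ C) :
      A.erase a \ ((A.erase a \ D) ∪ N) = D ∧ ((A.erase a \ D) ∪ N) \ A = N := by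
    have hNA : ∀ i ∈ N, i ∉ A := fun i hi => (mem_sdiff.1 (hN hi)).2
    have hDA : ∀ i ∈ D, i ∈ A.erase a := fun i hi => (mem_inter.1 (hD hi)).1
    constructor
    all_goals
      ext i
      have := hNA i
      have := hDA i
      simp only [mem_sdiff, mem_union, mem_erase] at *
      tauto
  refine Finset.card_nbij' (fun B => ⟨A.erase a \ B, B \ A⟩)
    (fun p => (A.erase a \ p.1) ∪ p.2) ?_ ?_ ?_ ?_
  · intro B hB
    simp only [coe_filter, mem_univ, true_and, Set.mem_ofPred_eq] at hB
    obtain ⟨haB, h1, h2, h3⟩ := hB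
    simp only [coe_sigma, Set.mem_sigma_iff, mem_coe, mem_powerset, mem_union, mem_powersetCard]
    have h4 : B \ A ⊆ C := fun i hi => mem_sdiff.2 ⟨h2 hi, (mem_sdiff.1 hi).2⟩
    refine ⟨fun i hi => mem_inter.2 ⟨(mem_sdiff.1 hi).1, (mem_inter.1 (h1 hi)).2⟩, ?_⟩
    exact h3.imp (⟨h4, ·⟩) (⟨h4, ·⟩)
  · rintro ⟨D, N⟩ hp
    simp only [coe_sigma, Set.mem_sigma_iff, mem_coe, mem_powerset, mem_union,
      mem_powersetCard] at hp
    obtain ⟨hD, hN⟩ := hp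
    have hNC : N ⊆ C := hN.elim (·.1) (·.1)
    obtain ⟨e1, e2⟩ := hinv hD hNC
    simp only [coe_filter, mem_univ, true_and, Set.mem_ofPred_eq, e1, e2]
    refine ⟨?_, hD.trans (inter_subset_inter_right (erase_subset _ _)),
      hNC.trans sdiff_subset, hN.imp (·.2) (·.2)⟩
    simp only [mem_union, mem_sdiff, mem_erase, ne_eq, not_true_eq_false, false_and, false_or]
    exact fun h => (mem_sdiff.1 (hNC h)).2 haA
  · intro B hB
    simp only [coe_filter, mem_univ, true_and, Set.mem_ofPred_eq] at hB
    ext i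
    by_cases hi : i = a
    · subst hi
      simp [hB.1, haA]
    · simp only [mem_sdiff, mem_union, mem_erase]
      tauto
  · rintro ⟨D, N⟩ hp
    simp only [coe_sigma, Set.mem_sigma_iff, mem_coe, mem_powerset, mem_union,
      mem_powersetCard] at hp
    obtain ⟨hD, hN⟩ := hp
    obtain ⟨e1, e2⟩ := hinv hD (hN.elim (·.1) (·.1))
    simp only [e1, e2]

/-- The number of facet neighbours in `C⁰` of a corner in `C¹`. -/
lemma ncard_facet_neighbors {n : ℕ} [NeZero n] (hn : 2 ≤ n) {G : Matrix (Fin n) (Fin n) ℝ}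
    (hG : IsUnit G.det) (hGram : G * G.transpose = gramE n) {b c : Fin n}
    (hb : (b : ℕ) = 1) (hc : (c : ℕ) = 2) {A : Finset (Fin n)} (hA : 0 ∈ A) :
    Set.ncard {x' | x' ∈ cornerSet G 0 ∧ sharesFacet G (intPt G (indVec A)) x'} =
      ∑ k ∈ range ((A.erase 0 ∩ {b, c}).card + 1), (A.erase 0 ∩ {b, c}).card.choose k *
        (((univ \ {0, b, c}) \ A).card.choose k + ((univ \ {0, b, c}) \ A).card.choose (k + 1)) := by
  have ha : ((0 : Fin n) : ℕ) = 0 := by simp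
  have hab : 0 ≠ b := by rintro rfl; omega
  have hac : 0 ≠ c := by rintro rfl; omega
  have hbc : b ≠ c := by rintro rfl; omega
  rw [← card_filter_rootShape hA, ← Set.ncard_coe_finset,
    ← Set.ncard_image_of_injective _ ((intPt_injective hG).comp indVec_injective)]
  congr 1
  ext x'
  have hiff (B : Finset (Fin n)) (hB : 0 ∉ B) :=
    (sharesFacet_intPt_iff hn hG hGram ha hb hc (z := indVec A) (w := indVec B)
      (by simp [indVec, hA, hB])
      (fun i => by simp only [indVec]; split_ifs <;> norm_num)
      (fun i => by simp only [indVec]; split_ifs <;> norm_num)).trans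
      (rootShape_indVec_sub_iff hab hac hbc hA hB)
  rw [Set.mem_ofPred_eq, mem_cornerSet_zero_iff]
  simp only [coe_filter, mem_univ, true_and, Set.mem_image, Set.mem_ofPred_eq,
    Function.comp_apply]
  constructor
  · rintro ⟨⟨B, hB, rfl⟩, h⟩
    exact ⟨B, ⟨hB, (hiff B hB).1 h⟩, rfl⟩
  · rintro ⟨B, ⟨hB, h⟩, rfl⟩
    exact ⟨⟨B, hB, rfl⟩, (hiff B hB).2 h⟩

/-- The number of facet neighbours in `C⁰` of the corner `x_S + x_F + g₁`, for `F ⊆ {2, 3}`. -/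
lemma ncard_facet_neighbors_union {n : ℕ} [NeZero n] {G : Matrix (Fin n) (Fin n) ℝ}
    (hG : IsUnit G.det) (hGram : G * G.transpose = gramE n) {b c : Fin n}
    (hb : (b : ℕ) = 1) (hc : (c : ℕ) = 2) {S F : Finset (Fin n)} (hS : ∀ j ∈ S, 3 ≤ (j : ℕ))
    (hF : F ⊆ {b, c}) :
    Set.ncard {x' | x' ∈ cornerSet G 0 ∧
        sharesFacet G (intPt G (indVec (insert 0 (F ∪ S)))) x'} =
      ∑ k ∈ range (F.card + 1), F.card.choose k *
        ((n - 3 - S.card).choose k + (n - 3 - S.card).choose (k + 1)) := by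
  have hab : 0 ≠ b := by rintro rfl; simp at hb
  have hac : 0 ≠ c := by rintro rfl; simp at hc
  have hbc : b ≠ c := by rintro rfl; omega
  have hF0 : 0 ∉ F := fun h => by simpa [hab, hac] using hF h
  have hS0 : 0 ∉ S := fun h => by simpa using hS 0 h
  have hSb : b ∉ S := fun h => by have := hS b h; omega
  have hSc : c ∉ S := fun h => by have := hS c h; omega
  have h0 : 0 ∉ F ∪ S := by simp [hS0, hF0]
  have e1 : (insert 0 (F ∪ S)).erase 0 ∩ {b, c} = F := by
    rw [erase_insert h0, union_inter_distrib_right, inter_eq_left.2 hF, union_eq_left]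
    intro i hi
    rcases mem_inter.1 hi with ⟨h1, h2⟩
    rcases mem_insert.1 h2 with rfl | h
    · exact absurd h1 hSb
    · exact absurd (mem_singleton.1 h ▸ h1) hSc
  have e2 : (univ \ {0, b, c}) \ insert 0 (F ∪ S) = univ \ ({0, b, c} ∪ S) := by
    ext i
    have := @hF i
    simp only [mem_sdiff, mem_univ, mem_insert, mem_singleton, mem_union, true_and] at *
    tauto
  have e3 : (univ \ ({0, b, c} ∪ S)).card = n - 3 - S.card := by
    rw [card_univ_sdiff, card_union_of_disjoint (by simp [hS0, hSb, hSc]),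
      card_insert_of_notMem (by simp [hab, hac]), card_pair hbc, Fintype.card_fin]
    omega
  rw [ncard_facet_neighbors (by have := c.isLt; omega) hG hGram hb hc (mem_insert_self _ _),
    e1, e2, e3]

/-- for the `Eₙ` basis (`6 ≤ n ≤ 8`) and `S ⊆ {4,…,n}` with `|S| = i`
(0-based: `S` avoids indices `0`, `1`, `2`): the corner `x_S + g₁ ∈ C¹` has `1 + (n−3−i)`
facet-neighbors in `C⁰`; the corners `x_S + g₂ + g₁` and `x_S + g₃ + g₁` each have
`1 + 2(n−3−i) + C(n−3−i,2)` of them; and the corner `x_S + g₂ + g₃ + g₁` has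
`1 + 3(n−3−i) + 3·C(n−3−i,2) + C(n−3−i,3)` of them. -/
theorem En_neighbor_counts (n : ℕ) [NeZero n] (hn6 : 6 ≤ n) (hn8 : n ≤ 8)
    (G : Matrix (Fin n) (Fin n) ℝ) (hG : IsUnit G.det)
    (hGram : G * G.transpose = gramE n)
    (S : Finset (Fin n)) (hS : ∀ j ∈ S, 3 ≤ (j : ℕ)) (i : ℕ) (hSi : S.card = i) :
    let xS : Fin n → ℝ := ∑ j ∈ S, G j
    Set.ncard {x' : Fin n → ℝ | x' ∈ cornerSet G 0 ∧
        sharesFacet G (xS + G ⟨0, by omega⟩) x'}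
      = 1 + (n - 3 - i) ∧
    Set.ncard {x' : Fin n → ℝ | x' ∈ cornerSet G 0 ∧
        sharesFacet G (xS + G ⟨1, by omega⟩ + G ⟨0, by omega⟩) x'}
      = 1 + 2 * (n - 3 - i) + Nat.choose (n - 3 - i) 2 ∧
    Set.ncard {x' : Fin n → ℝ | x' ∈ cornerSet G 0 ∧
        sharesFacet G (xS + G ⟨2, by omega⟩ + G ⟨0, by omega⟩) x'}
      = 1 + 2 * (n - 3 - i) + Nat.choose (n - 3 - i) 2 ∧
    Set.ncard {x' : Fin n → ℝ | x' ∈ cornerSet G 0 ∧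
        sharesFacet G (xS + G ⟨1, by omega⟩ + G ⟨2, by omega⟩ + G ⟨0, by omega⟩) x'}
      = 1 + 3 * (n - 3 - i) + 3 * Nat.choose (n - 3 - i) 2 + Nat.choose (n - 3 - i) 3 := by
  intro xS
  subst hSi
  have h0 : (⟨0, by omega⟩ : Fin n) = 0 := Fin.ext (by simp)
  set b : Fin n := ⟨1, by omega⟩ with hb
  set c : Fin n := ⟨2, by omega⟩ with hc
  have hbc : b ≠ c := by simp [hb, hc]
  have h0b : 0 ≠ b := h0 ▸ by simp [hb]
  have h0c : 0 ≠ c := h0 ▸ by simp [hc]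
  have h0S : 0 ∉ S := fun h => by simpa using hS 0 h
  have hbS : b ∉ S := fun h => by simpa [hb] using hS b h
  have hcS : c ∉ S := fun h => by simpa [hc] using hS c h
  have count {F : Finset (Fin n)} :=
    ncard_facet_neighbors_union hG hGram (b := b) (c := c) rfl rfl hS (F := F)
  have hxS : xS = intPt G (indVec S) := (intPt_indVec G S).symm
  rw [h0, hxS]
  refine ⟨?_, ?_, ?_, ?_⟩
  · have := count (F := ∅) (by simp)
    rw [empty_union, intPt_indVec_insert G h0S, add_comm] at this
    rw [this]
    simp
  · have := count (F := {b}) (by simp)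
    rw [singleton_union, intPt_indVec_insert G (by simp [h0b, h0S]),
      intPt_indVec_insert G hbS, add_comm, add_comm (G b)] at this
    rw [this]
    simp [sum_range_succ]
    omega
  · have := count (F := {c}) (by simp)
    rw [singleton_union, intPt_indVec_insert G (by simp [h0c, h0S]),
      intPt_indVec_insert G hcS, add_comm, add_comm (G c)] at this
    rw [this]
    simp [sum_range_succ]
    omega
  · have := count (F := {b, c}) subset_rfl
    rw [insert_union, singleton_union, intPt_indVec_insert G (by simp [h0b, h0c, h0S]),
      intPt_indVec_insert G (by simp [hbc, hbS]), intPt_indVec_insert G hcS, card_pair hbc,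
      add_comm, add_comm (G b), add_comm (G c), add_right_comm _ (G c)] at this
    rw [this]
    simp [sum_range_succ]
    omega
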